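/- arXiv:1009.3663 — 4 statements merged into one kernel-verified Lean document; each statement's English description precedes it below -/
import Mathlib

section
/- Let n, N be positive integers and let λ₁, …, λₙ ≥ 2 be real numbers with ∑_{j=1}^n λⱼ = N. Let A be an n×N real matrix whose columns all have Euclidean norm 1 and such that the symmetric matrix A·Aᵀ has eigenvalues λ₁, …, λₙ counted with multiplicity (i.e., there is an orthogonal matrix U with Uᵀ(AAᵀ)U = diag(λ₁,…,λₙ)). If the columns of A can be partitioned into m nonempty classes such that any two columns from different classes have disjoint supports, then m ≤ μ(λ₁,…,λₙ). -/
open Matrix BigOperators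

/- The maximal block number `μ(λ₁,…,λₙ)`: the maximum, over all permutations `σ`
of `{1,…,n}`, of the number of indices `s` for which the partial sum
`∑_{j=1}^s λ_{σ(j)}` is an integer. -/
open Classical in
noncomputable def maxBlockNumber {n : ℕ} (lam : Fin n → ℝ) : ℕ :=
  Finset.univ.sup fun σ : Equiv.Perm (Fin n) =>
    (Finset.univ.filter fun s : Fin n =>
      ∃ m : ℤ, ∑ j ∈ Finset.Iic s, lam (σ j) = (m : ℝ)).card

/-- If a symmetric real matrix with the characteristic polynomial of `diagonal lam` vanishes outside
the diagonal blocks given by a labelling `d`, then the `lam j` can be permuted so that their sum over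
each block is the partial trace over that block. -/
theorem exists_perm_sum_eq_of_blockDiagonal {ι α : Type*} [Fintype ι] [DecidableEq ι]
    [LinearOrder α] (lam : ι → ℝ) (M : Matrix ι ι ℝ) (hM : M.IsHermitian)
    (hchar : M.charpoly = (Matrix.diagonal lam).charpoly) (d : ι → α)
    (hd : ∀ k l, d k ≠ d l → M k l = 0) :
    ∃ τ : Equiv.Perm ι, ∀ p : α,
      ∑ k with d k = p, lam (τ k) = ∑ k with d k = p, M k k := by
  have hB : ∀ p : α, (M.toSquareBlock d p).IsHermitian := fun p => hM.submatrix _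
  let μ : ι → ℝ := fun k => (hB (d k)).eigenvalues ⟨k, rfl⟩
  have hμ : ∀ (p : α) (k : {k // d k = p}), μ k = (hB p).eigenvalues k := by
    rintro p ⟨k, rfl⟩
    rfl
  have htri : M.BlockTriangular d := fun k l h => hd k l h.ne'
  have hprod : ∏ k, (Polynomial.X - Polynomial.C (lam k)) =
      ∏ k, (Polynomial.X - Polynomial.C (μ k)) := by
    rw [← Matrix.charpoly_diagonal, ← hchar, htri.charpoly,
      ← Finset.prod_fiberwise_of_maps_to (s := Finset.univ) (t := Finset.image d Finset.univ)
        (g := d) (fun k _ => Finset.mem_image_of_mem d (Finset.mem_univ k))]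
    refine Finset.prod_congr rfl fun p _ => ?_
    rw [(hB p).charpoly_eq, Finset.prod_subtype (p := fun k => d k = p) _ (by simp)]
    refine Finset.prod_congr rfl fun k _ => ?_
    rw [hμ p k]
    rfl
  have hms : Multiset.map lam Finset.univ.val = Multiset.map μ Finset.univ.val := by
    have hroots : ∀ f : ι → ℝ, (∏ k, (Polynomial.X - Polynomial.C (f k))).roots =
        Multiset.map f Finset.univ.val := by
      intro f
      have := Polynomial.roots_multiset_prod_X_sub_C (Multiset.map f Finset.univ.val)
      rwa [Multiset.map_map] at this
    rw [← hroots, hprod, hroots]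
  obtain ⟨τ, hτ⟩ : ∃ τ : Equiv.Perm ι, μ = lam ∘ τ := by
    have hcard : ∀ x : ℝ, Nonempty ({k // μ k = x} ≃ {k // lam k = x}) := fun x => by
      have hcount := congrArg (Multiset.count x) hms
      rw [Multiset.count_map, Multiset.count_map] at hcount
      rw [← Fintype.card_eq, Fintype.card_subtype, Fintype.card_subtype]
      simpa [Finset.card_def, Finset.filter_val, eq_comm] using hcount.symm
    let e := fun x => (hcard x).some
    exact ⟨Equiv.ofFiberEquiv e, funext fun k => (Equiv.ofFiberEquiv_map e k).symm⟩
  refine ⟨τ, fun p => ?_⟩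
  have htr := (hB p).trace_eq_sum_eigenvalues
  rw [Finset.sum_subtype (p := fun k => d k = p) _ (by simp),
    Finset.sum_subtype (p := fun k => d k = p) (f := fun k => M k k) _ (by simp)]
  have : ∀ k : {k // d k = p}, lam (τ k) = (hB p).eigenvalues k := fun k => by
    rw [← hμ p k, hτ, Function.comp_apply]
  simp only [this]
  exact htr.symm

/-- If the sums of `lam` over the fibres of a surjective labelling of the indices by `Fin m` are
integers, then `m ≤ μ(lam)`. -/
theorem le_maxBlockNumber {n m : ℕ} (lam : Fin n → ℝ) (τ : Equiv.Perm (Fin n))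
    (d : Fin n → Fin m) (hd : Function.Surjective d) (w : Fin m → ℤ)
    (hw : ∀ p, ∑ k with d k = p, lam (τ k) = (w p : ℝ)) :
    m ≤ maxBlockNumber lam := by
  classical
  let ρ := Tuple.sort d
  have hmono : Monotone (d ∘ ρ) := Tuple.monotone_sort d
  have hlast : ∀ p : Fin m, ∃ s, d (ρ s) = p ∧ ∀ j, d (ρ j) ≤ p ↔ j ≤ s := by
    intro p
    obtain ⟨k, hk⟩ := hd p
    obtain ⟨s, hs, hmax⟩ := (Finset.univ.filter fun s => d (ρ s) = p).exists_max_image id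
      ⟨ρ.symm k, by simp [hk]⟩
    simp only [Finset.mem_filter, Finset.mem_univ, true_and, id] at hs hmax
    refine ⟨s, hs, fun j => ⟨fun hj => ?_, fun hj => hs ▸ hmono hj⟩⟩
    by_contra! hlt
    exact hlt.not_ge (hmax j (le_antisymm hj (hs ▸ hmono hlt.le)))
  choose s hs hle using hlast
  have hinj : Function.Injective s := fun p q h => by rw [← hs p, ← hs q, h]
  unfold maxBlockNumber
  refine le_trans ?_ (Finset.le_sup (Finset.mem_univ (ρ.trans τ)))
  calc m = (Finset.univ.image s).card := by
        rw [Finset.card_image_of_injective _ hinj, Finset.card_univ, Fintype.card_fin]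
    _ ≤ _ := by
      refine Finset.card_le_card fun t ht => ?_
      obtain ⟨p, -, rfl⟩ := Finset.mem_image.mp ht
      refine Finset.mem_filter.mpr ⟨Finset.mem_univ _, ∑ q ∈ Finset.Iic p, w q, ?_⟩
      push_cast
      simp only [← hw, Equiv.trans_apply]
      have hIic : Finset.Iic (s p) = Finset.univ.filter fun j => d (ρ j) ≤ p := by
        ext j
        simp [hle]
      rw [hIic, Finset.sum_filter, Equiv.sum_comp ρ fun k => if d k ≤ p then lam (τ k) else 0,
        ← Finset.sum_filter, ← Finset.sum_fiberwise_of_maps_to (t := Finset.Iic p) (g := d)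
          (fun k hk => by simpa using hk)]
      refine Finset.sum_congr rfl fun q hq => Finset.sum_congr ?_ fun _ _ => rfl
      ext k
      simp only [Finset.mem_filter, Finset.mem_univ, true_and, and_iff_right_iff_imp]
      rintro rfl
      exact Finset.mem_Iic.mp hq

theorem stmt_0 {n N : ℕ} (hn : 0 < n) (hN : 0 < N) (lam : Fin n → ℝ)
    (hlam : ∀ j, 2 ≤ lam j) (hsum : ∑ j, lam j = (N : ℝ))
    (A : Matrix (Fin n) (Fin N) ℝ)
    (hcol : ∀ i, ∑ k, (A k i) ^ 2 = 1)
    (hspec : ∃ U : Matrix (Fin n) (Fin n) ℝ, U * Uᵀ = 1 ∧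
      Uᵀ * (A * Aᵀ) * U = Matrix.diagonal lam)
    (m : ℕ) (c : Fin N → Fin m) (hc : Function.Surjective c)
    (hdisj : ∀ i₁ i₂ : Fin N, c i₁ ≠ c i₂ →
      ∀ k : Fin n, ¬(A k i₁ ≠ 0 ∧ A k i₂ ≠ 0)) :
    m ≤ maxBlockNumber lam := by
  obtain ⟨U, hU, hD⟩ := hspec
  have hU' : Uᵀ * U = 1 := mul_eq_one_comm.mp hU
  have hM : A * Aᵀ = U * Matrix.diagonal lam * Uᵀ := by
    rw [← hD]
    simp only [Matrix.mul_assoc, hU, Matrix.mul_one]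
    rw [← Matrix.mul_assoc U, hU, Matrix.one_mul]
  have hrow : ∀ k, ∃ i, A k i ≠ 0 := by
    intro k
    by_contra! h
    have h0 : (A * Aᵀ) k k = 0 := by simp [Matrix.mul_apply, h]
    have h1 : ∑ j, U k j * U k j = 1 := by
      simpa [Matrix.mul_apply] using congrFun (congrFun hU k) k
    have h2 : ∑ j, U k j * lam j * U k j = 0 := by
      rw [hM, Matrix.mul_apply] at h0
      simpa [Matrix.mul_diagonal] using h0
    have h3 : ∑ j, U k j * U k j ≤ ∑ j, U k j * lam j * U k j :=
      Finset.sum_le_sum fun j _ => by nlinarith [mul_self_nonneg (U k j), hlam j]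
    linarith
  choose r hr using hrow
  let d : Fin n → Fin m := fun k => c (r k)
  have hcd : ∀ k i, A k i ≠ 0 → c i = d k := fun k i h => by
    by_contra hne
    exact hdisj i (r k) hne k ⟨h, hr k⟩
  have hd : Function.Surjective d := by
    intro p
    obtain ⟨i, rfl⟩ := hc p
    have : ∃ k, A k i ≠ 0 := by
      by_contra! h
      simpa [h] using hcol i
    obtain ⟨k, hk⟩ := this
    exact ⟨k, (hcd k i hk).symm⟩
  have hchar : (A * Aᵀ).charpoly = (Matrix.diagonal lam).charpoly := by
    rw [← hD, Matrix.charpoly_mul_comm, ← Matrix.mul_assoc, hU, Matrix.one_mul]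
  obtain ⟨τ, hτ⟩ := exists_perm_sum_eq_of_blockDiagonal lam (A * Aᵀ)
    (by simpa using Matrix.isHermitian_mul_conjTranspose_self A) hchar d fun k l hkl => by
      rw [Matrix.mul_apply]
      refine Finset.sum_eq_zero fun i _ => ?_
      by_contra h
      exact hkl ((hcd k i (left_ne_zero_of_mul h)).symm.trans (hcd l i (right_ne_zero_of_mul h)))
  refine le_maxBlockNumber lam τ d hd (fun p => ((Finset.univ.filter fun i => c i = p).card : ℤ))
    fun p => ?_
  rw [hτ]
  simp only [Matrix.mul_apply, Matrix.transpose_apply]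
  rw [Finset.sum_comm]
  push_cast
  rw [Finset.card_filter]
  push_cast
  refine Finset.sum_congr rfl fun i _ => ?_
  rw [Finset.sum_filter]
  split_ifs with h
  · rw [← hcol i]
    refine Finset.sum_congr rfl fun k _ => ?_
    by_cases hk : A k i = 0
    · simp [hk]
    · rw [if_pos ((hcd k i hk).symm.trans h), sq]
  · refine Finset.sum_eq_zero fun k _ => ?_
    by_cases hk : A k i = 0
    · simp [hk]
    · rw [if_neg fun h' => h ((hcd k i hk).trans h')]
end

section
/- Let A be an n×N real matrix whose columns all have Euclidean norm 1 and whose rows are pairwise orthogonal and all nonzero. Suppose the columns of A cannot be partitioned into two nonempty classes such that any two columns from different classes have disjoint supports. Then A has at least N + 2(n − 1) nonzero entries. -/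
open Matrix BigOperators

/- The number of nonzero entries of a matrix. -/
open Classical in
noncomputable def nnzCount {n N : ℕ} (A : Matrix (Fin n) (Fin N) ℝ) : ℕ :=
  (Finset.univ.filter fun p : Fin n × Fin N => A p.1 p.2 ≠ 0).card

/-- The support of row `k` of a matrix, as a finset of column indices. -/
noncomputable def rowSupport {n N : ℕ} (A : Matrix (Fin n) (Fin N) ℝ) (k : Fin n) :
    Finset (Fin N) :=
  {i | A k i ≠ 0}

lemma mem_rowSupport {n N : ℕ} {A : Matrix (Fin n) (Fin N) ℝ} {k : Fin n} {i : Fin N} :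
    i ∈ rowSupport A k ↔ A k i ≠ 0 := by
  simp [rowSupport]

lemma nnzCount_eq_sum_card_rowSupport {n N : ℕ} (A : Matrix (Fin n) (Fin N) ℝ) :
    nnzCount A = ∑ k, (rowSupport A k).card := by
  classical
  simp only [nnzCount, rowSupport, Finset.card_filter, Fintype.sum_prod_type]

/-- Supports of orthogonal rows that meet do so in at least two columns. -/
lemma two_le_card_rowSupport_inter {n N : ℕ} {A : Matrix (Fin n) (Fin N) ℝ} {k l : Fin n}
    (horth : ∑ i, A k i * A l i = 0) {i : Fin N} (hk : A k i ≠ 0) (hl : A l i ≠ 0) :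
    2 ≤ (rowSupport A k ∩ rowSupport A l).card := by
  have hi : i ∈ rowSupport A k ∩ rowSupport A l := by simp [mem_rowSupport, hk, hl]
  refine Finset.one_lt_card.2 ⟨i, hi, ?_⟩
  by_contra! h
  refine mul_ne_zero hk hl ?_
  rw [← horth, eq_comm]
  refine Finset.sum_eq_single i (fun j _ hj => ?_) (by simp)
  by_contra hne
  exact hj (h j (by simpa [mem_rowSupport] using hne)).symm

/-- A proper nonempty set of rows of a connected matrix has a row outside it whose support meets
the support of one of its members. -/
lemma exists_row_meeting {n N : ℕ} {A : Matrix (Fin n) (Fin N) ℝ}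
    (hrownz : ∀ k : Fin n, ∃ i, A k i ≠ 0)
    (hconn : ¬ ∃ I : Finset (Fin N), I.Nonempty ∧ Iᶜ.Nonempty ∧
      ∀ i₁ ∈ I, ∀ i₂ ∈ Iᶜ, ∀ k : Fin n, ¬(A k i₁ ≠ 0 ∧ A k i₂ ≠ 0))
    {R : Finset (Fin n)} (hR : R.Nonempty) (hR' : R ≠ Finset.univ) :
    ∃ k ∉ R, ∃ l ∈ R, ∃ i, A k i ≠ 0 ∧ A l i ≠ 0 := by
  by_contra! h
  refine hconn ⟨R.biUnion (rowSupport A), ?_, ?_, ?_⟩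
  · obtain ⟨k, hk⟩ := hR
    obtain ⟨i, hi⟩ := hrownz k
    exact ⟨i, Finset.mem_biUnion.2 ⟨k, hk, mem_rowSupport.2 hi⟩⟩
  · obtain ⟨k, hk⟩ : ∃ k, k ∉ R := by
      by_contra! hall
      exact hR' (Finset.eq_univ_iff_forall.2 hall)
    obtain ⟨i, hi⟩ := hrownz k
    refine ⟨i, Finset.mem_compl.2 fun hmem => ?_⟩
    obtain ⟨l, hl, hli⟩ := Finset.mem_biUnion.1 hmem
    exact mem_rowSupport.1 hli (h k hk l hl i hi)
  · rintro i₁ h₁ i₂ h₂ k ⟨hk₁, hk₂⟩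
    obtain ⟨l, hl, hli⟩ := Finset.mem_biUnion.1 h₁
    by_cases hk : k ∈ R
    · exact Finset.mem_compl.1 h₂ (Finset.mem_biUnion.2 ⟨k, hk, mem_rowSupport.2 hk₂⟩)
    · exact mem_rowSupport.1 hli (h k hk l hl i₁ hk₁)

/-- Rows of a connected matrix with orthogonal rows can be collected one at a time, each new row
contributing at least two nonzero entries in columns already covered. -/
lemma exists_rows_card_biUnion_add_le {n N : ℕ} {A : Matrix (Fin n) (Fin N) ℝ}
    (hroworth : ∀ k₁ k₂ : Fin n, k₁ ≠ k₂ → ∑ i, A k₁ i * A k₂ i = 0)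
    (hrownz : ∀ k : Fin n, ∃ i, A k i ≠ 0)
    (hconn : ¬ ∃ I : Finset (Fin N), I.Nonempty ∧ Iᶜ.Nonempty ∧
      ∀ i₁ ∈ I, ∀ i₂ ∈ Iᶜ, ∀ k : Fin n, ¬(A k i₁ ≠ 0 ∧ A k i₂ ≠ 0))
    (m : ℕ) (hm : m + 1 ≤ n) :
    ∃ R : Finset (Fin n), R.card = m + 1 ∧
      (R.biUnion (rowSupport A)).card + 2 * m ≤ ∑ k ∈ R, (rowSupport A k).card := by
  induction m with
  | zero => exact ⟨{⟨0, hm⟩}, by simp⟩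
  | succ m ih =>
    obtain ⟨R, hcard, hle⟩ := ih (by lia)
    have hR : R.Nonempty := Finset.card_pos.1 (by lia)
    have hR' : R ≠ Finset.univ := by
      rintro rfl
      rw [Finset.card_univ, Fintype.card_fin] at hcard
      lia
    obtain ⟨k, hk, l, hl, i, hki, hli⟩ := exists_row_meeting hrownz hconn hR hR'
    refine ⟨insert k R, by rw [Finset.card_insert_of_notMem hk, hcard], ?_⟩
    have hkl : k ≠ l := by
      rintro rfl
      exact hk hl
    have htwo := two_le_card_rowSupport_inter (hroworth k l hkl) hki hli
    have hinter : (rowSupport A k ∩ rowSupport A l).card ≤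
        (rowSupport A k ∩ R.biUnion (rowSupport A)).card :=
      Finset.card_le_card
        (Finset.inter_subset_inter_left (Finset.subset_biUnion_of_mem _ hl))
    have hunion := Finset.card_union_add_card_inter (rowSupport A k) (R.biUnion (rowSupport A))
    rw [Finset.sum_insert hk, Finset.biUnion_insert]
    lia

theorem stmt_5 {n N : ℕ} (A : Matrix (Fin n) (Fin N) ℝ)
    (hcol : ∀ i, ∑ k, (A k i) ^ 2 = 1)
    (hroworth : ∀ k₁ k₂ : Fin n, k₁ ≠ k₂ → ∑ i, A k₁ i * A k₂ i = 0)
    (hrownz : ∀ k : Fin n, ∃ i, A k i ≠ 0)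
    (hconn : ¬ ∃ I : Finset (Fin N), I.Nonempty ∧ Iᶜ.Nonempty ∧
      ∀ i₁ ∈ I, ∀ i₂ ∈ Iᶜ, ∀ k : Fin n, ¬(A k i₁ ≠ 0 ∧ A k i₂ ≠ 0)) :
    N + 2 * (n - 1) ≤ nnzCount A := by
  obtain _ | m := n
  · obtain _ | N := N
    · simp
    · simpa using hcol 0
  obtain ⟨R, hcard, hle⟩ :=
    exists_rows_card_biUnion_add_le hroworth hrownz hconn m le_rfl
  obtain rfl : R = Finset.univ := Finset.eq_univ_of_card R (by simpa using hcard)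
  have hcover : Finset.univ.biUnion (rowSupport A) = Finset.univ := by
    refine Finset.eq_univ_iff_forall.2 fun i => ?_
    by_contra hi
    have hzero : ∀ k, A k i = 0 := by simpa [mem_rowSupport] using hi
    simpa [hzero] using hcol i
  rw [hcover, Finset.card_univ, Fintype.card_fin] at hle
  simpa [nnzCount_eq_sum_card_rowSupport] using hle
end

section
/- Let n, N be positive integers and let λ₁, …, λₙ ≥ 2 be real numbers with ∑_{j=1}^n λⱼ = N. Then there exists an n×N real matrix A such that: all columns of A have Euclidean norm 1; the rows of A are pairwise orthogonal and the k-th row has squared Euclidean norm λₖ (so that A·Aᵀ = diag(λ₁,…,λₙ)); every column of A has at most 2 nonzero entries; and the total number of nonzero entries of A is exactly N + 2(n − μ(λ₁,…,λₙ)). -/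
open Matrix BigOperators

/-- Cut points `0 = a 0 ≤ b 0 ≤ a 1 ≤ b 1 ≤ ⋯` of the Spectral Tetris construction: `a k` and `f k`
are the integer and fractional parts of the `k`-th partial sum, and `[a k, b k)` carries the
`2 × 2` block shared by rows `k - 1` and `k`, which is absent when `f k = 0`. -/
structure IsTetrisCut (a b : ℕ → ℕ) (f : ℕ → ℝ) : Prop where
  a_zero : a 0 = 0
  f_zero : f 0 = 0
  b_le : ∀ k, b k ≤ a (k + 1)
  block : ∀ k, (f k = 0 ∧ b k = a k) ∨ (0 < f k ∧ f k < 1 ∧ b k = a k + 2)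

/-- The entry in row `k` and column `i` of the Spectral Tetris matrix with the given cut points. -/
noncomputable def tetrisEntry (a b : ℕ → ℕ) (f : ℕ → ℝ) (k i : ℕ) : ℝ :=
  if i < a k then 0
  else if i < b k then (if i = a k then √(1 - f k / 2) else -√(1 - f k / 2))
  else if i < a (k + 1) then 1
  else if i < b (k + 1) then √(f (k + 1) / 2)
  else 0

namespace IsTetrisCut

variable {a b : ℕ → ℕ} {f : ℕ → ℝ}

lemma a_le_b (h : IsTetrisCut a b f) (k : ℕ) : a k ≤ b k := by
  rcases h.block k with h | h <;> omega

lemma a_mono (h : IsTetrisCut a b f) : Monotone a :=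
  monotone_nat_of_le_succ fun k => (h.a_le_b k).trans (h.b_le k)

lemma b_mono (h : IsTetrisCut a b f) : Monotone b :=
  monotone_nat_of_le_succ fun k => (h.b_le k).trans (h.a_le_b (k + 1))

lemma b_le_a (h : IsTetrisCut a b f) {k l : ℕ} (hkl : k < l) : b k ≤ a l :=
  (h.b_le k).trans (h.a_mono hkl)

lemma f_nonneg (h : IsTetrisCut a b f) (k : ℕ) : 0 ≤ f k := by
  rcases h.block k with h | h <;> linarith [h.1]

lemma f_lt_one (h : IsTetrisCut a b f) (k : ℕ) : f k < 1 := by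
  rcases h.block k with ⟨h, -⟩ | ⟨-, h, -⟩ <;> linarith

lemma entry_ne_zero_iff (h : IsTetrisCut a b f) (k i : ℕ) :
    tetrisEntry a b f k i ≠ 0 ↔ a k ≤ i ∧ i < b (k + 1) := by
  have h1 := h.a_le_b k
  have h2 := h.b_le k
  have h3 := h.a_le_b (k + 1)
  unfold tetrisEntry
  split_ifs with c1 c2 c3 c4 c5
  · simp; omega
  · have hf : 0 < √(1 - f k / 2) := Real.sqrt_pos.2 (by linarith [h.f_lt_one k])
    exact ⟨fun _ => by omega, fun _ => hf.ne'⟩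
  · have hf : 0 < √(1 - f k / 2) := Real.sqrt_pos.2 (by linarith [h.f_lt_one k])
    exact ⟨fun _ => by omega, fun _ => neg_ne_zero.2 hf.ne'⟩
  · simp; omega
  · have hf : 0 < √(f (k + 1) / 2) := Real.sqrt_pos.2 (by
      rcases h.block (k + 1) with h | h
      · omega
      · linarith [h.1])
    exact ⟨fun _ => by omega, fun _ => hf.ne'⟩
  · simp; omega

lemma entry_eq_zero (h : IsTetrisCut a b f) {k i : ℕ} (hi : i < a k ∨ b (k + 1) ≤ i) :
    tetrisEntry a b f k i = 0 := by
  by_contra hne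
  have := (h.entry_ne_zero_iff k i).1 hne
  omega

lemma sq_entry_head (h : IsTetrisCut a b f) {k i : ℕ} (h1 : a k ≤ i) (h2 : i < b k) :
    tetrisEntry a b f k i ^ 2 = 1 - f k / 2 := by
  have hf : 0 ≤ 1 - f k / 2 := by linarith [h.f_lt_one k]
  unfold tetrisEntry
  rw [if_neg (by omega), if_pos h2]
  split_ifs <;> simp [Real.sq_sqrt hf]

lemma entry_middle (h : IsTetrisCut a b f) {k i : ℕ} (h1 : b k ≤ i) (h2 : i < a (k + 1)) :
    tetrisEntry a b f k i = 1 := by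
  have := h.a_le_b k
  unfold tetrisEntry
  rw [if_neg (by omega), if_neg (by omega), if_pos h2]

lemma entry_tail (h : IsTetrisCut a b f) {k i : ℕ} (h1 : a (k + 1) ≤ i) (h2 : i < b (k + 1)) :
    tetrisEntry a b f k i = √(f (k + 1) / 2) := by
  have := h.a_le_b k
  have := h.b_le k
  unfold tetrisEntry
  rw [if_neg (by omega), if_neg (by omega), if_neg (by omega), if_pos h2]

lemma sq_entry_tail (h : IsTetrisCut a b f) {k i : ℕ} (h1 : a (k + 1) ≤ i) (h2 : i < b (k + 1)) :
    tetrisEntry a b f k i ^ 2 = f (k + 1) / 2 := by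
  rw [h.entry_tail h1 h2, Real.sq_sqrt (by linarith [h.f_nonneg (k + 1)])]

lemma sum_sq_row (h : IsTetrisCut a b f) {k N : ℕ} (hN : b (k + 1) ≤ N) :
    ∑ i ∈ Finset.range N, tetrisEntry a b f k i ^ 2 =
      (a (k + 1) + f (k + 1)) - (a k + f k) := by
  have h1 := h.a_le_b k
  have h2 := h.b_le k
  have h3 := h.a_le_b (k + 1)
  have hsub : ∑ i ∈ Finset.Ico (a k) (b (k + 1)), tetrisEntry a b f k i ^ 2 =
      ∑ i ∈ Finset.range N, tetrisEntry a b f k i ^ 2 := by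
    refine Finset.sum_subset (fun i hi => ?_) (fun i _ hi => ?_)
    · simp only [Finset.mem_Ico, Finset.mem_range] at hi ⊢
      omega
    · simp only [Finset.mem_Ico] at hi
      rw [h.entry_eq_zero (by omega), zero_pow two_ne_zero]
  have e1 : ∑ i ∈ Finset.Ico (a k) (b k), tetrisEntry a b f k i ^ 2 =
      (b k - a k : ℝ) * (1 - f k / 2) := by
    rw [Finset.sum_congr rfl fun i hi => h.sq_entry_head (Finset.mem_Ico.1 hi).1
      (Finset.mem_Ico.1 hi).2]
    rw [Finset.sum_const, Nat.card_Ico, nsmul_eq_mul, Nat.cast_sub h1]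
  have e2 : ∑ i ∈ Finset.Ico (b k) (a (k + 1)), tetrisEntry a b f k i ^ 2 =
      (a (k + 1) - b k : ℝ) := by
    rw [Finset.sum_congr rfl fun i hi => by
      rw [h.entry_middle (Finset.mem_Ico.1 hi).1 (Finset.mem_Ico.1 hi).2]]
    simp [Nat.cast_sub h2]
  have e3 : ∑ i ∈ Finset.Ico (a (k + 1)) (b (k + 1)), tetrisEntry a b f k i ^ 2 =
      (b (k + 1) - a (k + 1) : ℝ) * (f (k + 1) / 2) := by
    rw [Finset.sum_congr rfl fun i hi => h.sq_entry_tail (Finset.mem_Ico.1 hi).1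
      (Finset.mem_Ico.1 hi).2]
    rw [Finset.sum_const, Nat.card_Ico, nsmul_eq_mul, Nat.cast_sub h3]
  rw [← hsub, ← Finset.sum_Ico_consecutive _ (h1.trans h2) h3,
    ← Finset.sum_Ico_consecutive _ h1 h2, e1, e2, e3]
  rcases h.block k with ⟨p, q⟩ | ⟨-, -, q⟩ <;>
    rcases h.block (k + 1) with ⟨r, s⟩ | ⟨-, -, s⟩ <;>
    simp only [*] <;> push_cast <;> ring

lemma sum_mul_row (h : IsTetrisCut a b f) {k l N : ℕ} (hkl : k < l) (hN : b l ≤ N) :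
    ∑ i ∈ Finset.range N, tetrisEntry a b f k i * tetrisEntry a b f l i = 0 := by
  rcases eq_or_lt_of_le (Nat.succ_le_of_lt hkl) with rfl | hl
  · rw [Nat.succ_eq_add_one] at *
    have hsub : ∑ i ∈ Finset.Ico (a (k + 1)) (b (k + 1)),
          tetrisEntry a b f k i * tetrisEntry a b f (k + 1) i =
        ∑ i ∈ Finset.range N, tetrisEntry a b f k i * tetrisEntry a b f (k + 1) i := by
      refine Finset.sum_subset (fun i hi => ?_) (fun i _ hi => ?_)
      · simp only [Finset.mem_Ico, Finset.mem_range] at hi ⊢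
        omega
      · simp only [Finset.mem_Ico] at hi
        by_cases hi' : i < a (k + 1)
        · rw [h.entry_eq_zero (k := k + 1) (.inl hi'), mul_zero]
        · rw [h.entry_eq_zero (k := k) (by omega), zero_mul]
    rw [← hsub]
    rcases h.block (k + 1) with ⟨-, q⟩ | ⟨-, -, q⟩
    · simp [q]
    · have e1 : tetrisEntry a b f (k + 1) (a (k + 1)) = √(1 - f (k + 1) / 2) := by
        simp [tetrisEntry, q]
      have e2 : tetrisEntry a b f (k + 1) (a (k + 1) + 1) = -√(1 - f (k + 1) / 2) := by
        simp [tetrisEntry, q]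
      rw [q, Finset.sum_Ico_succ_top (by omega), Finset.sum_Ico_succ_top (by omega),
        Finset.Ico_self, Finset.sum_empty, e1, e2,
        h.entry_tail le_rfl (by omega), h.entry_tail (by omega) (by omega)]
      ring
  · refine Finset.sum_eq_zero fun i _ => ?_
    by_cases hi : i < a l
    · rw [h.entry_eq_zero (k := l) (.inl hi), mul_zero]
    · have := h.b_le_a hl
      rw [h.entry_eq_zero (k := k) (.inr (by simp at this; omega)), zero_mul]

lemma exists_mem_Ico (h : IsTetrisCut a b f) {n i : ℕ} (hi : i < a n) :
    ∃ k < n, a k ≤ i ∧ i < a (k + 1) := by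
  induction n with
  | zero => simp [h.a_zero] at hi
  | succ n ih =>
    by_cases hn : i < a n
    · obtain ⟨k, hk, hk'⟩ := ih hn
      exact ⟨k, by omega, hk'⟩
    · exact ⟨n, by omega, by omega, hi⟩

lemma sum_sq_column (h : IsTetrisCut a b f) {n i : ℕ} (hi : i < a n) :
    ∑ k ∈ Finset.range n, tetrisEntry a b f k i ^ 2 = 1 := by
  obtain ⟨k, hk, h1, h2⟩ := h.exists_mem_Ico hi
  by_cases hb : b k ≤ i
  · rw [Finset.sum_eq_single k, h.entry_middle hb h2, one_pow]
    · intro l _ hl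
      rw [h.entry_eq_zero, zero_pow two_ne_zero]
      rcases lt_or_gt_of_ne hl with hl | hl
      · exact .inr ((h.b_mono hl).trans hb)
      · exact .inl (h2.trans_le (h.a_mono hl))
    · exact fun hk' => absurd (Finset.mem_range.2 hk) hk'
  · obtain _ | m := k
    · rcases h.block 0 with ⟨-, q⟩ | ⟨q, -⟩
      · omega
      · exact absurd h.f_zero q.ne'
    · have hsub : ∑ k ∈ ({m, m + 1} : Finset ℕ), tetrisEntry a b f k i ^ 2 =
          ∑ k ∈ Finset.range n, tetrisEntry a b f k i ^ 2 := by
        refine Finset.sum_subset (fun l hl => ?_) (fun l _ hl => ?_)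
        · simp only [Finset.mem_insert, Finset.mem_singleton, Finset.mem_range] at hl ⊢
          omega
        · simp only [Finset.mem_insert, Finset.mem_singleton, not_or] at hl
          rw [h.entry_eq_zero, zero_pow two_ne_zero]
          rcases lt_or_gt_of_ne hl.1 with hl' | hl'
          · exact .inr ((h.b_le_a (show l + 1 < m + 1 by omega)).trans h1)
          · exact .inl (h2.trans_le (h.a_mono (by omega)))
      rw [← hsub, Finset.sum_pair (by omega), h.sq_entry_tail h1 (by omega),
        h.sq_entry_head h1 (by omega)]
      ring

lemma card_column_le_two (h : IsTetrisCut a b f) (n i : ℕ) :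
    ((Finset.univ : Finset (Fin n)).filter fun k : Fin n => tetrisEntry a b f k i ≠ 0).card ≤ 2 := by
  by_contra! hc
  obtain ⟨x, y, z, hx, hy, hz, hxy, hxz, hyz⟩ := Finset.two_lt_card_iff.1 hc
  simp only [Finset.mem_filter, Finset.mem_univ, true_and, h.entry_ne_zero_iff] at hx hy hz
  have key : ∀ u v : Fin n, i < b (u + 1) → a v ≤ i → (v : ℕ) ≤ u + 1 := by
    intro u v hu hv
    by_contra! huv
    exact absurd (h.b_le_a huv) (by omega)
  have := key x y hx.2 hy.1
  have := key y x hy.2 hx.1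
  have := key x z hx.2 hz.1
  have := key z x hz.2 hx.1
  have := key y z hy.2 hz.1
  have := key z y hz.2 hy.1
  omega

lemma card_row (h : IsTetrisCut a b f) {k N : ℕ} (hN : b (k + 1) ≤ N) :
    ((Finset.univ : Finset (Fin N)).filter fun i : Fin N => tetrisEntry a b f k i ≠ 0).card =
      b (k + 1) - a k := by
  rw [← Nat.card_Ico, ← Finset.card_map Fin.valEmbedding]
  congr 1
  ext i
  simp only [Finset.mem_map, Finset.mem_filter, Finset.mem_univ, true_and, h.entry_ne_zero_iff,
    Fin.valEmbedding_apply, Finset.mem_Ico]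
  constructor
  · rintro ⟨j, hj, rfl⟩
    exact hj
  · exact fun hi => ⟨⟨i, by omega⟩, hi, rfl⟩

open Classical in
lemma sum_card_row (h : IsTetrisCut a b f) (n : ℕ) :
    ∑ k ∈ Finset.range n, (b (k + 1) - a k) =
      a n + 2 * ((Finset.range n).filter fun k => f (k + 1) ≠ 0).card := by
  induction n with
  | zero => simp [h.a_zero]
  | succ n ih =>
    have := h.a_le_b n
    have := h.b_le n
    rw [Finset.sum_range_succ, ih, Finset.range_add_one, Finset.filter_insert]
    rcases h.block (n + 1) with ⟨p, q⟩ | ⟨p, -, q⟩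
    · rw [if_neg (by simp [p])]
      omega
    · rw [if_pos p.ne', Finset.card_insert_of_notMem (by simp)]
      omega

end IsTetrisCut

lemma isTetrisCut_floor_fract (ell : ℕ → ℝ) (hell : ∀ k, 2 ≤ ell k) :
    IsTetrisCut (fun k => ⌊∑ j ∈ Finset.range k, ell j⌋₊)
      (fun k => ⌊∑ j ∈ Finset.range k, ell j⌋₊ +
        if Int.fract (∑ j ∈ Finset.range k, ell j) = 0 then 0 else 2)
      (fun k => Int.fract (∑ j ∈ Finset.range k, ell j)) where
  a_zero := by simp
  f_zero := by simp
  b_le k := by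
    have h0 : 0 ≤ ∑ j ∈ Finset.range k, ell j :=
      Finset.sum_nonneg fun j _ => by linarith [hell j]
    have h2 : ⌊∑ j ∈ Finset.range k, ell j⌋₊ + 2 ≤ ⌊∑ j ∈ Finset.range (k + 1), ell j⌋₊ := by
      apply Nat.le_floor
      rw [Finset.sum_range_succ]
      push_cast
      linarith [Nat.floor_le h0, hell k]
    split_ifs <;> omega
  block k := by
    by_cases hk : Int.fract (∑ j ∈ Finset.range k, ell j) = 0
    · exact .inl ⟨hk, by simp [hk]⟩
    · exact .inr ⟨lt_of_le_of_ne (Int.fract_nonneg _) (Ne.symm hk), Int.fract_lt_one _,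
        by simp [hk]⟩

lemma sum_Iic_eq_sum_range {n : ℕ} (g : Fin n → ℝ) (ell : ℕ → ℝ) (hg : ∀ j : Fin n, ell j = g j)
    (s : Fin n) : ∑ j ∈ Finset.Iic s, g j = ∑ j ∈ Finset.range (s + 1), ell j := by
  have : Finset.range (s + 1) = (Finset.Iic s).map Fin.valEmbedding := by
    rw [Fin.map_valEmbedding_Iic]
    ext i
    simp
  rw [this, Finset.sum_map]
  exact Finset.sum_congr rfl fun j _ => (hg j).symm

open Classical in
lemma exists_spectralTetris {n N : ℕ} (lam : Fin n → ℝ) (hlam : ∀ j, 2 ≤ lam j)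
    (hsum : ∑ j, lam j = (N : ℝ)) :
    ∃ A : Matrix (Fin n) (Fin N) ℝ,
      (∀ i, ∑ k, (A k i) ^ 2 = 1) ∧
      A * Aᵀ = Matrix.diagonal lam ∧
      (∀ i : Fin N, (Finset.univ.filter fun k : Fin n => A k i ≠ 0).card ≤ 2) ∧
      nnzCount A = N + 2 * (n - (Finset.univ.filter fun s : Fin n =>
        ∃ m : ℤ, ∑ j ∈ Finset.Iic s, lam j = (m : ℝ)).card) := by
  set ell : ℕ → ℝ := fun j => if hj : j < n then lam ⟨j, hj⟩ else 2 with hell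
  have hell2 : ∀ k, 2 ≤ ell k := fun k => by
    simp only [hell]
    split_ifs
    · exact hlam _
    · exact le_rfl
  have hellj : ∀ j : Fin n, ell j = lam j := fun j => by simp [hell]
  have hS : ∑ j ∈ Finset.range n, ell j = N := by
    rw [← hsum, Finset.sum_range]
    exact Finset.sum_congr rfl fun j _ => hellj j
  have h := isTetrisCut_floor_fract ell hell2
  set a : ℕ → ℕ := fun k => ⌊∑ j ∈ Finset.range k, ell j⌋₊ with ha
  set f : ℕ → ℝ := fun k => Int.fract (∑ j ∈ Finset.range k, ell j) with hf
  set b : ℕ → ℕ := fun k => a k + if f k = 0 then 0 else 2 with hb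
  have hadd : ∀ k, (a k : ℝ) + f k = ∑ j ∈ Finset.range k, ell j := fun k => by
    have h0 : 0 ≤ ∑ j ∈ Finset.range k, ell j :=
      Finset.sum_nonneg fun j _ => by linarith [hell2 j]
    simp only [ha, hf]
    rw [natCast_floor_eq_intCast_floor h0, Int.floor_add_fract]
  have han : a n = N := by simp [ha, hS]
  have hfn : f n = 0 := by simp [hf, hS]
  have hbn : b n = N := by simp [hb, han, hfn]
  have hbN : ∀ k : Fin n, b (k + 1) ≤ N := fun k => hbn ▸ h.b_mono k.2
  refine ⟨Matrix.of fun k i => tetrisEntry a b f k i, fun i => ?_, ?_, fun i => ?_, ?_⟩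
  · rw [← h.sum_sq_column (n := n) (i := i) (by omega), Finset.sum_range]
    rfl
  · ext k l
    simp only [Matrix.mul_apply, Matrix.transpose_apply, Matrix.of_apply]
    rw [← Finset.sum_range fun i => tetrisEntry a b f k i * tetrisEntry a b f l i]
    rcases lt_trichotomy k l with hkl | rfl | hkl
    · rw [Matrix.diagonal_apply_ne _ hkl.ne,
        h.sum_mul_row hkl ((h.b_mono (Nat.le_succ _)).trans (hbN l))]
    · simp only [← pow_two]
      rw [Matrix.diagonal_apply_eq, h.sum_sq_row (hbN k), hadd, hadd, Finset.sum_range_succ,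
        hellj]
      ring
    · rw [Matrix.diagonal_apply_ne _ hkl.ne']
      simp only [mul_comm (tetrisEntry a b f k _)]
      exact h.sum_mul_row hkl ((h.b_mono (Nat.le_succ _)).trans (hbN k))
  · exact h.card_column_le_two n i
  · have hint : ∀ s : Fin n,
        (∃ m : ℤ, ∑ j ∈ Finset.Iic s, lam j = (m : ℝ)) ↔ f (s + 1) = 0 := fun s => by
      rw [sum_Iic_eq_sum_range lam ell hellj s]
      simp only [hf, Int.fract_eq_zero_iff, Set.mem_range]
      exact exists_congr fun m => eq_comm
    have hcard : (Finset.univ.filter fun s : Fin n =>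
          ∃ m : ℤ, ∑ j ∈ Finset.Iic s, lam j = (m : ℝ)).card +
        ((Finset.range n).filter fun k => f (k + 1) ≠ 0).card = n := by
      simp only [hint]
      rw [Finset.card_filter _ (Finset.range n), Finset.sum_range, ← Finset.card_filter,
        Finset.card_filter_add_card_filter_not, Finset.card_univ, Fintype.card_fin]
    have hrow : nnzCount (Matrix.of fun (k : Fin n) (i : Fin N) => tetrisEntry a b f k i) =
        ∑ k ∈ Finset.range n, (b (k + 1) - a k) := by
      rw [nnzCount, Finset.card_filter, Fintype.sum_prod_type, Finset.sum_range]
      refine Finset.sum_congr rfl fun k _ => ?_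
      rw [← h.card_row (hbN k), Finset.card_filter]
      rfl
    rw [hrow, h.sum_card_row, han]
    omega

open Classical in
theorem stmt_7 {n N : ℕ} (hn : 0 < n) (hN : 0 < N) (lam : Fin n → ℝ)
    (hlam : ∀ j, 2 ≤ lam j) (hsum : ∑ j, lam j = (N : ℝ)) :
    ∃ A : Matrix (Fin n) (Fin N) ℝ,
      (∀ i, ∑ k, (A k i) ^ 2 = 1) ∧
      A * Aᵀ = Matrix.diagonal lam ∧
      (∀ i : Fin N, (Finset.univ.filter fun k : Fin n => A k i ≠ 0).card ≤ 2) ∧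
      nnzCount A = N + 2 * (n - maxBlockNumber lam) := by
  obtain ⟨σ, -, hσ⟩ := Finset.exists_mem_eq_sup Finset.univ Finset.univ_nonempty
    fun σ : Equiv.Perm (Fin n) => (Finset.univ.filter fun s : Fin n =>
      ∃ m : ℤ, ∑ j ∈ Finset.Iic s, lam (σ j) = (m : ℝ)).card
  obtain ⟨A, hcol, hrow, hcard, hnnz⟩ := exists_spectralTetris (N := N) (fun j => lam (σ j))
    (fun j => hlam (σ j)) ((Equiv.sum_comp σ lam).trans hsum)
  refine ⟨A.submatrix σ.symm id, fun i => ?_, ?_, fun i => ?_, ?_⟩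
  · rw [← hcol i]
    exact Equiv.sum_comp σ.symm fun k => A k i ^ 2
  · rw [Matrix.transpose_submatrix, ← Matrix.submatrix_mul _ _ _ _ _ Function.bijective_id, hrow,
      Matrix.submatrix_diagonal _ _ σ.symm.injective]
    congr 1
    ext k
    simp
  · refine le_trans (le_of_eq ?_) (hcard i)
    rw [Finset.card_filter, Finset.card_filter]
    exact Equiv.sum_comp σ.symm fun k => if A k i ≠ 0 then 1 else 0
  · rw [maxBlockNumber, hσ, ← hnnz, nnzCount, nnzCount, Finset.card_filter, Finset.card_filter,
      Fintype.sum_prod_type, Fintype.sum_prod_type]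
    exact Equiv.sum_comp σ.symm fun k => ∑ i, if A k i ≠ 0 then 1 else 0
end

section
/- There exist two distinct 4×9 real matrices A and B (not equal even after permuting columns) such that each has all columns of Euclidean norm 1, satisfies A·Aᵀ = (9/4)·Id₄ and B·Bᵀ = (9/4)·Id₄, and each has exactly 15 = 9 + 2(4 − 1) nonzero entries. Hence an optimally sparse frame in a class ℱ(N,{λᵢ}) is in general not uniquely determined. -/
open Matrix BigOperators

/-- A chain-shaped pattern: consecutive rows share one pair of columns. -/
def chainFrame (a b c d e f : ℝ) : Matrix (Fin 4) (Fin 9) ℝ :=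
  !![1, 1, a, a, 0, 0, 0, 0, 0;
     0, 0, b, -b, c, c, 0, 0, 0;
     0, 0, 0, 0, d, -d, e, e, 0;
     0, 0, 0, 0, 0, 0, f, -f, 1]

/-- A star-shaped pattern: the first row shares one pair of columns with each other row. -/
def starFrame (e f : ℝ) : Matrix (Fin 4) (Fin 9) ℝ :=
  !![e, e, 0, e, e, 0, e, e, 0;
     f, -f, 1, 0, 0, 0, 0, 0, 0;
     0, 0, 0, f, -f, 1, 0, 0, 0;
     0, 0, 0, 0, 0, 0, f, -f, 1]

lemma nnzCount_eq_sum {n N : ℕ} (A : Matrix (Fin n) (Fin N) ℝ) :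
    nnzCount A = ∑ i, ∑ j, open Classical in if A i j ≠ 0 then 1 else 0 := by
  rw [nnzCount, Finset.card_filter, Fintype.sum_prod_type]

lemma nnzCount_chainFrame {a b c d e f : ℝ} (ha : a ≠ 0) (hb : b ≠ 0) (hc : c ≠ 0)
    (hd : d ≠ 0) (he : e ≠ 0) (hf : f ≠ 0) : nnzCount (chainFrame a b c d e f) = 15 := by
  simp [nnzCount_eq_sum, chainFrame, Fin.sum_univ_succ, *]

lemma nnzCount_starFrame {e f : ℝ} (he : e ≠ 0) (hf : f ≠ 0) :
    nnzCount (starFrame e f) = 15 := by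
  simp [nnzCount_eq_sum, starFrame, Fin.sum_univ_succ, *]

lemma sum_sq_chainFrame {a b c d e f : ℝ} (hab : a ^ 2 + b ^ 2 = 1) (hcd : c ^ 2 + d ^ 2 = 1)
    (hef : e ^ 2 + f ^ 2 = 1) (i : Fin 9) : ∑ k, chainFrame a b c d e f k i ^ 2 = 1 := by
  fin_cases i <;> simp [chainFrame, Fin.sum_univ_succ, *]

lemma sum_sq_starFrame {e f : ℝ} (hef : e ^ 2 + f ^ 2 = 1) (i : Fin 9) :
    ∑ k, starFrame e f k i ^ 2 = 1 := by
  fin_cases i <;> simp [starFrame, Fin.sum_univ_succ, *]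

lemma chainFrame_mul_transpose {a b c d e f : ℝ} (ha : a ^ 2 = 1 / 8) (hb : b ^ 2 = 7 / 8)
    (hc : c ^ 2 = 1 / 4) (hd : d ^ 2 = 3 / 4) (he : e ^ 2 = 3 / 8) (hf : f ^ 2 = 5 / 8) :
    chainFrame a b c d e f * (chainFrame a b c d e f)ᵀ =
      ((9 : ℝ) / 4) • (1 : Matrix (Fin 4) (Fin 4) ℝ) := by
  ext i j
  fin_cases i <;> fin_cases j <;>
    simp [chainFrame, Matrix.mul_apply, Fin.sum_univ_succ] <;> linarith

lemma starFrame_mul_transpose {e f : ℝ} (he : e ^ 2 = 3 / 8) (hf : f ^ 2 = 5 / 8) :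
    starFrame e f * (starFrame e f)ᵀ = ((9 : ℝ) / 4) • (1 : Matrix (Fin 4) (Fin 4) ℝ) := by
  ext i j
  fin_cases i <;> fin_cases j <;>
    simp [starFrame, Matrix.mul_apply, Fin.sum_univ_succ] <;> linarith

lemma chainFrame_ne_submatrix_starFrame {a b c d e f e' f' : ℝ} (he : e' ≠ 1)
    (σ : Equiv.Perm (Fin 9)) :
    chainFrame a b c d e f ≠ (starFrame e' f').submatrix id σ := by
  intro h
  have h0 : starFrame e' f' 0 (σ 0) = 1 := by
    simpa [chainFrame] using (congrFun (congrFun h 0) 0).symm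
  generalize σ 0 = j at h0
  fin_cases j <;> simp [starFrame] at h0 <;> exact he h0

/- There exist two 4×9 synthesis matrices of unit-norm tight frames for ℝ⁴,
each with the optimal number 15 = 9 + 2(4-1) of nonzero entries, which do not
agree even up to a permutation of their columns. Hence optimally sparse frames
are in general not uniquely determined. -/
theorem stmt_12 :
    ∃ A B : Matrix (Fin 4) (Fin 9) ℝ,
      (∀ i, ∑ k, (A k i) ^ 2 = 1) ∧
      (∀ i, ∑ k, (B k i) ^ 2 = 1) ∧
      A * Aᵀ = ((9 : ℝ) / 4) • (1 : Matrix (Fin 4) (Fin 4) ℝ) ∧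
      B * Bᵀ = ((9 : ℝ) / 4) • (1 : Matrix (Fin 4) (Fin 4) ℝ) ∧
      nnzCount A = 15 ∧ nnzCount B = 15 ∧
      ∀ σ : Equiv.Perm (Fin 9), A ≠ B.submatrix id σ := by
  have pos {x : ℝ} (hx : 0 < x) : √x ≠ 0 := (Real.sqrt_pos.2 hx).ne'
  have sq {x : ℝ} (hx : 0 < x) : √x ^ 2 = x := Real.sq_sqrt hx.le
  have ha := sq (x := 1 / 8) (by norm_num)
  have hb := sq (x := 7 / 8) (by norm_num)
  have hc := sq (x := 1 / 4) (by norm_num)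
  have hd := sq (x := 3 / 4) (by norm_num)
  have he := sq (x := 3 / 8) (by norm_num)
  have hf := sq (x := 5 / 8) (by norm_num)
  refine ⟨chainFrame √(1 / 8) √(7 / 8) √(1 / 4) √(3 / 4) √(3 / 8) √(5 / 8),
    starFrame √(3 / 8) √(5 / 8), sum_sq_chainFrame ?_ ?_ ?_, sum_sq_starFrame ?_,
    chainFrame_mul_transpose ha hb hc hd he hf, starFrame_mul_transpose he hf,
    nnzCount_chainFrame ?_ ?_ ?_ ?_ ?_ ?_, nnzCount_starFrame ?_ ?_,
    chainFrame_ne_submatrix_starFrame ?_⟩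
  any_goals exact pos (by norm_num)
  any_goals linarith
  intro h
  norm_num [h] at he
end
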